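/- Let k be a field, let n and s be positive integers, and let m be the char(k)-free part of n. Then s_n(k((x₁,…,x_s))) = s_n(k((x₁))…((x_s))) = s_m(k), where k((x₁,…,x_s)) is the fraction field of k[[x₁,…,x_s]] and k((x₁))…((x_s)) is the s-fold iterated Laurent series field over k. Moreover, if s_n(k) < ∞, then w_n(k((x₁,…,x_s))) = w_n(k((x₁))…((x_s))) = s_m(k)+1 if m > 1, and both equal 1 if m = 1. -/

import Mathlib

/-- `a` is a sum of finitely many `n`-th powers in `R`. -/
def IsSumOfPowers (R : Type*) [CommRing R] (n : ℕ) (a : R) : Prop :=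
  ∃ l : ℕ, ∃ x : Fin l → R, a = ∑ i, x i ^ n

/-- The `n`-length of `a ∈ R`: the least positive integer `g` such that `a` is a sum of
`g` `n`-th powers of elements of `R`, or `∞` if no such `g` exists. -/
noncomputable def nLength (R : Type*) [CommRing R] (n : ℕ) (a : R) : ℕ∞ :=
  sInf {g : ℕ∞ | ∃ l : ℕ, g = l ∧ 0 < l ∧ ∃ x : Fin l → R, a = ∑ i, x i ^ n}

/-- The `n`-th level of `R`: `s_n(R) = ℓ_n(-1)`. -/
noncomputable def level (R : Type*) [CommRing R] (n : ℕ) : ℕ∞ :=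
  nLength R n (-1)

/-- The `n`-th Waring number of `R`: the least positive integer `g` such that every element of
`R` which is a sum of finitely many `n`-th powers is a sum of at most `g` `n`-th powers,
or `∞` if no such `g` exists. -/
noncomputable def waring (R : Type*) [CommRing R] (n : ℕ) : ℕ∞ :=
  sInf {g : ℕ∞ | ∃ l : ℕ, g = l ∧ 0 < l ∧
    ∀ a : R, IsSumOfPowers R n a → nLength R n a ≤ l}

/-- `m` is the `p`-free part of `n`: if `p = 0` then `m = n`, and otherwise `n = p ^ j * m`
with `p ∤ m`. -/
def IsFreePart (p n m : ℕ) : Prop :=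
  (p = 0 ∧ m = n) ∨ (p ≠ 0 ∧ ¬ p ∣ m ∧ ∃ j : ℕ, n = p ^ j * m)

/-- Auxiliary construction: the `s`-fold iterated Laurent series field over `k`,
bundled with its field structure. -/
noncomputable def IterLaurentAux (k : Type) [Field k] : ℕ → (T : Type) × Field T
  | 0 => ⟨k, ‹Field k›⟩
  | s + 1 =>
      let prev := IterLaurentAux k s
      letI := prev.2
      ⟨LaurentSeries prev.1, inferInstance⟩

/-- The `s`-fold iterated Laurent series field `k((x₁))…((x_s))` over `k`. -/
def IterLaurent (k : Type) [Field k] (s : ℕ) : Type := (IterLaurentAux k s).1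

noncomputable instance IterLaurent.instField (k : Type) [Field k] (s : ℕ) :
    Field (IterLaurent k s) := (IterLaurentAux k s).2

theorem IterLaurent_zero (k : Type) [Field k] : IterLaurent k 0 = k := rfl

theorem IterLaurent_succ (k : Type) [Field k] (s : ℕ) :
    IterLaurent k (s + 1) = LaurentSeries (IterLaurent k s) := rfl

theorem nLength_le_natCast_iff {R : Type*} [CommRing R] {n : ℕ} (hn : 0 < n) (a : R) (l : ℕ) :
    nLength R n a ≤ l ↔ 0 < l ∧ ∃ x : Fin l → R, a = ∑ i, x i ^ n := by
  constructor
  · intro h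
    have hne : {g : ℕ∞ | ∃ l : ℕ, g = l ∧ 0 < l ∧ ∃ x : Fin l → R, a = ∑ i, x i ^ n}.Nonempty := by
      by_contra hempty
      rw [Set.not_nonempty_iff_eq_empty] at hempty
      rw [nLength, hempty, sInf_empty] at h
      exact ENat.natCast_ne_top l (top_le_iff.mp h)
    obtain ⟨l', hl', hpos, x, hx⟩ := csInf_mem hne
    change nLength R n a = l' at hl'
    rw [hl', Nat.cast_le] at h
    obtain ⟨d, rfl⟩ := Nat.exists_eq_add_of_le h
    exact ⟨by omega, Fin.append x 0, by simp [Fin.sum_univ_add, hn.ne', hx]⟩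
  · rintro ⟨hl, x, hx⟩
    exact sInf_le ⟨l, rfl, hl, x, hx⟩

theorem one_le_waring (R : Type*) [CommRing R] (n : ℕ) : 1 ≤ waring R n := by
  refine le_sInf ?_
  rintro _ ⟨l, rfl, hl, -⟩
  exact_mod_cast hl

theorem waring_one (R : Type*) [CommRing R] : waring R 1 = 1 := by
  refine le_antisymm (sInf_le ⟨1, by simp, one_pos, fun a _ => ?_⟩) (one_le_waring R 1)
  exact (nLength_le_natCast_iff one_pos a 1).mpr ⟨one_pos, fun _ => a, by simp⟩

section Frobenius

variable {R : Type*} [CommRing R] [IsReduced R] (q : ℕ) [ExpChar R q] (j m : ℕ)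

theorem eq_sum_pow_iff_of_expChar {ι : Type*} [Fintype ι] (a : R) (x : ι → R) :
    a ^ q ^ j = ∑ i, x i ^ (q ^ j * m) ↔ a = ∑ i, x i ^ m := by
  have h : ∑ i, x i ^ (q ^ j * m) = (∑ i, x i ^ m) ^ q ^ j := by
    rw [sum_pow_char_pow q]
    simp_rw [← pow_mul, mul_comm]
  rw [h]
  exact (iterateFrobenius_inj R q j).eq_iff

theorem nLength_pow_expChar_pow (a : R) :
    nLength R (q ^ j * m) (a ^ q ^ j) = nLength R m a := by
  simp only [nLength, eq_sum_pow_iff_of_expChar]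

theorem level_expChar_pow_mul : level R (q ^ j * m) = level R m := by
  rw [level, level, ← nLength_pow_expChar_pow q j m (-1 : R), neg_one_pow_expChar_pow R q j]

theorem waring_expChar_pow_mul : waring R (q ^ j * m) = waring R m := by
  have h (l : ℕ) : (∀ a : R, IsSumOfPowers R (q ^ j * m) a → nLength R (q ^ j * m) a ≤ l) ↔
      ∀ a : R, IsSumOfPowers R m a → nLength R m a ≤ l := by
    constructor
    · rintro h a ⟨r, x, hx⟩
      rw [← nLength_pow_expChar_pow q j]
      exact h _ ⟨r, x, (eq_sum_pow_iff_of_expChar q j m a x).mpr hx⟩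
    · rintro h a ⟨r, x, hx⟩
      obtain rfl : (∑ i, x i ^ m) ^ q ^ j = a :=
        ((eq_sum_pow_iff_of_expChar q j m _ x).mpr rfl).trans hx.symm
      rw [nLength_pow_expChar_pow]
      exact h _ ⟨r, x, rfl⟩
  simp only [waring, h]

end Frobenius

theorem exists_neg_one_eq_sum_pow {F : Type*} [Field F] {m l : ℕ} {c : Fin (l + 1) → F}
    (hc : ∃ i, c i ≠ 0) (h : ∑ i, c i ^ m = 0) : ∃ x : Fin l → F, -1 = ∑ i, x i ^ m := by
  obtain ⟨i, hi⟩ := hc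
  refine ⟨fun t => c (i.succAbove t) / c i, ?_⟩
  rw [Fin.sum_univ_succAbove _ i] at h
  simp_rw [div_pow, ← Finset.sum_div]
  rw [eq_div_iff (pow_ne_zero _ hi)]
  linear_combination -h

theorem level_le_of_sum_pow_eq_zero {F : Type*} [Field F] {m l : ℕ} (hm : 0 < m)
    {c : Fin (l + 1) → F} (hc : ∃ i, c i ≠ 0) (h : ∑ i, c i ^ m = 0) : level F m ≤ l := by
  obtain ⟨x, hx⟩ := exists_neg_one_eq_sum_pow hc h
  refine (nLength_le_natCast_iff hm _ l).mpr ⟨Nat.pos_of_ne_zero ?_, x, hx⟩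
  rintro rfl
  simp at hx

namespace MvPowerSeries

theorem exists_pow_eq_one_add {σ F : Type*} [Field F] {m : ℕ} (hm : (m : F) ≠ 0)
    {h : MvPowerSeries σ F} (hh : constantCoeff h = 0) : ∃ g, g ^ m = 1 + h := by
  let P : PowerSeries F := (1 + PowerSeries.X) ^ m - 1
  have hP : PowerSeries.constantCoeff P = 0 := by simp [P]
  have hP1 : PowerSeries.coeff 1 P = m := by
    have : P = (((1 + Polynomial.X) ^ m - 1 : Polynomial F) : PowerSeries F) := by simp [P]
    rw [this, Polynomial.coeff_coe, Polynomial.coeff_sub, Polynomial.coeff_one_add_X_pow]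
    simp [Polynomial.coeff_one]
  let _ : Invertible (PowerSeries.coeff 1 P) := invertibleOfNonzero (hP1 ▸ hm)
  have hQ : PowerSeries.HasSubst P.substInv := .substInv P
  have key : (1 + P.substInv) ^ m = 1 + PowerSeries.X := by
    rw [← PowerSeries.subst_substInv_right P hP, ← PowerSeries.coe_substAlgHom hQ]
    simp only [P, map_sub, map_pow, map_add, map_one, PowerSeries.substAlgHom_X]
    ring
  have hs : PowerSeries.HasSubst h := .of_constantCoeff_zero hh
  refine ⟨PowerSeries.substAlgHom hs (1 + P.substInv), ?_⟩
  rw [← map_pow, key, map_add, map_one, PowerSeries.substAlgHom_X]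

section LeadingCoeff

variable {σ : Type*} [LinearOrder σ] [WellFoundedGT σ]

theorem coeff_add_mul_of_le_lexOrder {R : Type*} [Semiring R] {φ ψ : MvPowerSeries σ R}
    {p q : σ →₀ ℕ} (hp : toLex p ≤ lexOrder φ) (hq : toLex q ≤ lexOrder ψ) :
    coeff (p + q) (φ * ψ) = coeff p φ * coeff q ψ := by
  rw [coeff_mul, Finset.sum_eq_single_of_mem ⟨p, q⟩ (by simp)]
  rintro ⟨u, v⟩ h h'
  rw [Finset.HasAntidiagonal.mem_antidiagonal] at h
  rcases trichotomy_of_add_eq_add (congrArg toLex h) with h'' | h'' | h''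
  · exact False.elim (h' (Prod.ext h''.1 h''.2))
  · rw [coeff_eq_zero_of_lt_lexOrder (lt_of_lt_of_le (WithTop.coe_lt_coe.mpr h'') hp), zero_mul]
  · rw [coeff_eq_zero_of_lt_lexOrder (lt_of_lt_of_le (WithTop.coe_lt_coe.mpr h'') hq), mul_zero]

theorem coeff_nsmul_pow_of_le_lexOrder {R : Type*} [Semiring R] {φ : MvPowerSeries σ R}
    {d : σ →₀ ℕ} (hd : toLex d ≤ lexOrder φ) (m : ℕ) :
    toLex (m • d) ≤ lexOrder (φ ^ m) ∧ coeff (m • d) (φ ^ m) = coeff d φ ^ m := by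
  induction m with
  | zero =>
    refine ⟨le_lexOrder_iff.mpr fun e he => ?_, by simp⟩
    rw [zero_smul, WithTop.coe_lt_coe] at he
    exact absurd he (not_lt_of_ge (Finsupp.toLex_monotone zero_le))
  | succ m ih =>
    rw [succ_nsmul, pow_succ, pow_succ, coeff_add_mul_of_le_lexOrder ih.1 hd, ih.2]
    refine ⟨?_, rfl⟩
    rw [toLex_add, WithTop.coe_add]
    exact (add_le_add ih.1 hd).trans (le_lexOrder_mul _ _)

theorem le_lexOrder_sum {R ι : Type*} [Semiring R] {w : WithTop (Lex (σ →₀ ℕ))} {s : Finset ι}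
    {f : ι → MvPowerSeries σ R} (h : ∀ i ∈ s, w ≤ lexOrder (f i)) :
    w ≤ lexOrder (∑ i ∈ s, f i) := by
  rw [le_lexOrder_iff]
  intro d hd
  rw [map_sum]
  exact Finset.sum_eq_zero fun i hi => coeff_eq_zero_of_lt_lexOrder (hd.trans_le (h i hi))

/-- The lowest coefficients of a finite family of power series, not all zero, at the least
lexicographic order attained in the family. -/
theorem exists_leading_coeffs {R ι : Type*} [Semiring R] [Fintype ι]
    {f : ι → MvPowerSeries σ R} (hf : ∃ i, f i ≠ 0) (m : ℕ) :
    ∃ (d : σ →₀ ℕ) (c : ι → R), (∃ i, c i ≠ 0) ∧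
      toLex (m • d) ≤ lexOrder (∑ i, f i ^ m) ∧ coeff (m • d) (∑ i, f i ^ m) = ∑ i, c i ^ m := by
  obtain ⟨i₀, h₀⟩ := hf
  obtain ⟨i, -, hi⟩ := Finset.exists_min_image Finset.univ (fun i => lexOrder (f i)) ⟨i₀, by simp⟩
  have hfi : f i ≠ 0 := by
    intro h
    have := hi i₀ (by simp)
    rw [h, lexOrder_zero, top_le_iff, lexOrder_eq_top_iff_eq_zero] at this
    exact h₀ this
  obtain ⟨d, hd⟩ := exists_finsupp_eq_lexOrder_of_ne_zero hfi
  have key (t : ι) := coeff_nsmul_pow_of_le_lexOrder (hd ▸ hi t (by simp)) m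
  refine ⟨d, fun t => coeff d (f t), ⟨i, coeff_ne_zero_of_lexOrder hd.symm⟩,
    le_lexOrder_sum fun t _ => (key t).1, ?_⟩
  rw [map_sum]
  exact Finset.sum_congr rfl fun t _ => (key t).2

theorem level_le_of_sum_pow_eq_zero {F : Type*} [Field F] {m l : ℕ} (hm : 0 < m)
    {f : Fin (l + 1) → MvPowerSeries σ F} (hf : ∃ i, f i ≠ 0) (h : ∑ i, f i ^ m = 0) :
    level F m ≤ l := by
  obtain ⟨d, c, hc, -, hsum⟩ := exists_leading_coeffs hf m
  rw [h, map_zero] at hsum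
  exact _root_.level_le_of_sum_pow_eq_zero hm hc hsum.symm

theorem level_add_one_le_of_sum_pow_eq_X_mul_pow {F : Type*} [Field F] {m l : ℕ} (hm : 1 < m)
    {f : Fin l → MvPowerSeries σ F} {i : σ} {g : MvPowerSeries σ F} (hg : g ≠ 0)
    (h : ∑ t, f t ^ m = X i * g ^ m) : level F m + 1 ≤ l := by
  obtain ⟨e, he⟩ := exists_finsupp_eq_lexOrder_of_ne_zero hg
  obtain ⟨hge, hgc⟩ := coeff_nsmul_pow_of_le_lexOrder he.ge m
  have hXi : ((toLex (Finsupp.single i 1) : Lex (σ →₀ ℕ)) : WithTop (Lex (σ →₀ ℕ))) ≤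
      lexOrder (X i : MvPowerSeries σ F) := by
    rw [le_lexOrder_iff]
    intro u hu
    rw [coeff_X, if_neg]
    rintro rfl
    exact lt_irrefl _ hu
  have hco : coeff (Finsupp.single i 1 + m • e) (X i * g ^ m) ≠ 0 := by
    rw [coeff_add_mul_of_le_lexOrder hXi hge, hgc, coeff_X, if_pos rfl, one_mul]
    exact pow_ne_zero _ (coeff_ne_zero_of_lexOrder he.symm)
  have hle' := (add_le_add hXi hge).trans (le_lexOrder_mul _ _)
  have hf : ∃ t, f t ≠ 0 := by
    by_contra! hf
    refine hco ?_
    rw [← h]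
    simp [hf, (zero_lt_one.trans hm).ne']
  obtain ⟨d, c, hc, hle, hsum⟩ := exists_leading_coeffs hf m
  suffices h0 : ∑ t, c t ^ m = 0 by
    obtain _ | l := l
    · exact hc.choose.elim0
    · exact_mod_cast add_le_add_left (_root_.level_le_of_sum_pow_eq_zero (by omega) hc h0) 1
  rw [← hsum]
  apply coeff_eq_zero_of_lt_lexOrder
  refine lt_of_le_of_ne hle fun heq => ?_
  rw [h] at heq
  have h1 := heq.trans (le_antisymm (lexOrder_le_of_coeff_ne_zero hco) hle')
  have h2 : m • d = Finsupp.single i 1 + m • e := toLex.injective (WithTop.coe_injective h1)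
  have h3 := DFunLike.congr_fun h2 i
  simp only [Finsupp.smul_apply, Finsupp.add_apply, Finsupp.single_eq_same, smul_eq_mul] at h3
  have : m ∣ 1 := (Nat.dvd_add_left ⟨e i, rfl⟩).mp ⟨d i, h3.symm⟩
  exact hm.ne' (Nat.dvd_one.mp this)

end LeadingCoeff

/-- Any finite family of fractions of power series has a common denominator. -/
theorem exists_common_denominator (σ : Type*) {F K : Type*} [Field F] [Field K]
    [Algebra (MvPowerSeries σ F) K] [IsFractionRing (MvPowerSeries σ F) K] {ι : Type*} [Fintype ι]
    (x : ι → K) :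
    ∃ (g : MvPowerSeries σ F) (f : ι → MvPowerSeries σ F), g ≠ 0 ∧
      ∀ i, algebraMap _ K (f i) = algebraMap _ K g * x i := by
  obtain ⟨b, hb⟩ := IsLocalization.exist_integer_multiples_of_finite
    (nonZeroDivisors (MvPowerSeries σ F)) x
  choose f hf using hb
  exact ⟨b, f, nonZeroDivisors.ne_zero b.2, fun i => by rw [hf, Algebra.smul_def]⟩

theorem nLength_fractionField_le (σ : Type*) {F K : Type*} [Field F] [Field K]
    [Algebra (MvPowerSeries σ F) K] [IsFractionRing (MvPowerSeries σ F) K] {m : ℕ}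
    [Nonempty σ] (hm : (m : F) ≠ 0) (a : K) :
    nLength K m a ≤ level F m + 1 := by
  have hm0 : m ≠ 0 := by rintro rfl; simp at hm
  obtain hl | hl := eq_or_ne (level F m) ⊤
  · simp [hl]
  obtain ⟨l, hl⟩ := ENat.ne_top_iff_exists.mp hl
  obtain ⟨-, c, hc⟩ := (nLength_le_natCast_iff hm0.bot_lt _ l).mp hl.ge
  obtain ⟨p, q, hq, rfl⟩ := IsFractionRing.div_surjective (A := MvPowerSeries σ F) a
  obtain ⟨i⟩ := ‹Nonempty σ›
  have hq0 : q ≠ 0 := nonZeroDivisors.ne_zero hq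
  have hX : (X i : MvPowerSeries σ F) ≠ 0 := fun h => by
    simpa [coeff_X] using congrArg (coeff (Finsupp.single i 1)) h
  set y : K := algebraMap _ K (q * X i) with hy
  have hy0 : y ≠ 0 := by simpa [hy] using ⟨hq0, hX⟩
  obtain ⟨g, hg⟩ := exists_pow_eq_one_add (σ := σ) hm (h := p * q ^ (m - 1) * X i ^ m)
    (by simp [hm0])
  have hsum : p * q ^ (m - 1) * X i ^ m = g ^ m + ∑ t, C (c t) ^ m := by
    have := congrArg (C (σ := σ)) hc
    simp only [map_neg, map_one, map_sum, map_pow] at this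
    rw [hg, ← this]
    ring
  rw [← hl]
  refine (nLength_le_natCast_iff hm0.bot_lt _ (l + 1)).mpr ⟨l.succ_pos,
    fun t => algebraMap _ K (Fin.cons (α := fun _ => MvPowerSeries σ F) g (fun t => C (c t)) t) / y,
    ?_⟩
  simp_rw [div_pow, ← Finset.sum_div, ← map_pow, ← map_sum]
  rw [Fin.sum_univ_succ]
  simp only [Fin.cons_zero, Fin.cons_succ]
  rw [← hsum, eq_div_iff (pow_ne_zero _ hy0), div_mul_eq_mul_div,
    div_eq_iff (by simpa using hq0), hy, ← map_pow, ← map_mul, ← map_mul]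
  congr 1
  obtain ⟨r, rfl⟩ := Nat.exists_eq_succ_of_ne_zero hm0
  simp only [Nat.succ_eq_add_one, Nat.add_sub_cancel]
  ring

theorem level_fractionField (σ : Type*) {F K : Type*} [LinearOrder σ] [WellFoundedGT σ]
    [Field F] [Field K]
    [Algebra (MvPowerSeries σ F) K] [IsFractionRing (MvPowerSeries σ F) K] {m : ℕ}
    (hm : 0 < m) : level K m = level F m := by
  have hinj := IsFractionRing.injective (MvPowerSeries σ F) K
  have h (l : ℕ) : level K m ≤ l ↔ level F m ≤ l := by
    constructor
    · intro h
      obtain ⟨-, x, hx⟩ := (nLength_le_natCast_iff hm _ l).mp h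
      obtain ⟨g, f, hg, hf⟩ := exists_common_denominator σ (F := F) x
      refine level_le_of_sum_pow_eq_zero (σ := σ) hm (f := Fin.cons g f) ⟨0, hg⟩ (hinj ?_)
      simp only [Fin.sum_univ_succ, Fin.cons_zero, Fin.cons_succ, map_add, map_sum, map_pow, hf,
        mul_pow, ← Finset.mul_sum, ← hx, map_zero]
      ring
    · intro h
      obtain ⟨hl, x, hx⟩ := (nLength_le_natCast_iff hm _ l).mp h
      refine (nLength_le_natCast_iff hm _ l).mpr ⟨hl, fun i => algebraMap _ K (C (σ := σ) (x i)), ?_⟩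
      simpa using congrArg (fun y => algebraMap _ K (C (σ := σ) y)) hx
  exact eq_of_forall_ge_iff fun c => by
    obtain rfl | hc := eq_or_ne c ⊤
    · simp
    · obtain ⟨l, rfl⟩ := ENat.ne_top_iff_exists.mp hc
      exact h l

theorem waring_fractionField (σ : Type*) {F K : Type*} [LinearOrder σ] [WellFoundedGT σ]
    [Field F] [Field K]
    [Algebra (MvPowerSeries σ F) K] [IsFractionRing (MvPowerSeries σ F) K] {m : ℕ}
    [Nonempty σ] (hm : (m : F) ≠ 0) (hm1 : 1 < m) (h : level F m < ⊤) :
    waring K m = level F m + 1 := by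
  have hm0 : 0 < m := by omega
  refine le_antisymm ?_ (le_sInf ?_)
  · obtain ⟨l, hl⟩ := ENat.ne_top_iff_exists.mp h.ne
    refine sInf_le ⟨l + 1, by simp [← hl], l.succ_pos, fun a _ => ?_⟩
    simpa [← hl] using nLength_fractionField_le σ hm a
  · rintro _ ⟨l, rfl, -, hl⟩
    obtain ⟨i⟩ := ‹Nonempty σ›
    set a : K := algebraMap (MvPowerSeries σ F) K (X i) with ha
    have hfin : nLength K m a ≤ l := by
      refine hl a ?_
      obtain ⟨r, hr⟩ := ENat.ne_top_iff_exists.mp h.ne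
      have := nLength_fractionField_le σ (F := F) hm a
      rw [← hr] at this
      obtain ⟨-, x, hx⟩ := (nLength_le_natCast_iff hm0 _ (r + 1)).mp this
      exact ⟨_, x, hx⟩
    obtain ⟨-, x, hx⟩ := (nLength_le_natCast_iff hm0 _ l).mp hfin
    obtain ⟨g, f, hg, hf⟩ := exists_common_denominator σ (F := F) x
    refine level_add_one_le_of_sum_pow_eq_X_mul_pow hm1 (i := i) (f := f) hg
      (IsFractionRing.injective _ K ?_)
    simp only [map_sum, map_pow, map_mul, hf, mul_pow, ← Finset.mul_sum, ← hx, ha]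
    ring

end MvPowerSeries

theorem level_laurentSeries {F : Type*} [Field F] {m : ℕ} (hm : 0 < m) :
    level (LaurentSeries F) m = level F m :=
  let _ : Algebra (MvPowerSeries Unit F) (LaurentSeries F) :=
    inferInstanceAs (Algebra (PowerSeries F) (LaurentSeries F))
  have : IsFractionRing (MvPowerSeries Unit F) (LaurentSeries F) :=
    inferInstanceAs (IsFractionRing (PowerSeries F) (LaurentSeries F))
  MvPowerSeries.level_fractionField Unit hm

theorem waring_laurentSeries {F : Type*} [Field F] {m : ℕ} (hm : (m : F) ≠ 0) (hm1 : 1 < m)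
    (h : level F m < ⊤) : waring (LaurentSeries F) m = level F m + 1 :=
  let _ : Algebra (MvPowerSeries Unit F) (LaurentSeries F) :=
    inferInstanceAs (Algebra (PowerSeries F) (LaurentSeries F))
  have : IsFractionRing (MvPowerSeries Unit F) (LaurentSeries F) :=
    inferInstanceAs (IsFractionRing (PowerSeries F) (LaurentSeries F))
  MvPowerSeries.waring_fractionField Unit hm hm1 h

theorem nonempty_ringHom_iterLaurent (k : Type) [Field k] (s : ℕ) :
    Nonempty (k →+* IterLaurent k s) := by
  induction s with
  | zero => exact ⟨RingHom.id k⟩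
  | succ s ih =>
    obtain ⟨φ⟩ := ih
    have ψ : k →+* LaurentSeries (IterLaurent k s) := HahnSeries.C.comp φ
    exact ⟨ψ⟩

theorem level_iterLaurent (k : Type) [Field k] {m : ℕ} (hm : 0 < m) (s : ℕ) :
    level (IterLaurent k s) m = level k m := by
  induction s with
  | zero => rfl
  | succ s ih => exact (level_laurentSeries (F := IterLaurent k s) hm).trans ih

theorem waring_iterLaurent_succ (k : Type) [Field k] {m : ℕ} (hm : (m : k) ≠ 0) (hm1 : 1 < m)
    (h : level k m < ⊤) (s : ℕ) : waring (IterLaurent k (s + 1)) m = level k m + 1 := by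
  have hm' : (m : IterLaurent k s) ≠ 0 := by
    obtain ⟨φ⟩ := nonempty_ringHom_iterLaurent k s
    rw [← map_natCast φ]
    exact (map_ne_zero φ).mpr hm
  rw [← level_iterLaurent k (by omega) s] at h ⊢
  exact waring_laurentSeries (F := IterLaurent k s) hm' hm1 h

theorem IsFreePart.exists_expChar {k : Type*} [Field k] {n m : ℕ} (hn : 0 < n)
    (h : IsFreePart (ringChar k) n m) :
    (m : k) ≠ 0 ∧ ∃ q j : ℕ, ExpChar k q ∧ n = q ^ j * m := by
  obtain ⟨hp, rfl⟩ | ⟨hp, hdvd, j, hj⟩ := h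
  · refine ⟨fun h0 => ?_, 1, 0, ?_, by simp⟩
    · rw [ringChar.spec, hp, zero_dvd_iff] at h0
      omega
    · have : CharP k 0 := ringChar.of_eq hp
      have := CharP.charP_to_charZero k
      exact .zero
  · refine ⟨fun h0 => hdvd ((ringChar.spec k m).mp h0), ringChar k, j, ?_, hj⟩
    exact .prime ((CharP.char_is_prime_or_zero k (ringChar k)).resolve_right hp)

/-- Let `k` be a field, `n, s` positive integers, `m` the `char(k)`-free part
of `n`. Then `s_n(k((x₁,…,x_s))) = s_n(k((x₁))…((x_s))) = s_m(k)`, and if `s_n(k) < ∞` then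
`w_n(k((x₁,…,x_s))) = w_n(k((x₁))…((x_s))) = s_m(k)+1` if `m > 1`, both being `1` if
`m = 1`. Here `k((x₁,…,x_s))` is the fraction field of `k[[x₁,…,x_s]]`. -/
theorem level_and_waring_laurentSeries (k : Type) [Field k] (n m s : ℕ)
    (hn : 0 < n) (hs : 0 < s) (hm : IsFreePart (ringChar k) n m) :
    level (FractionRing (MvPowerSeries (Fin s) k)) n = level k m ∧
      level (IterLaurent k s) n = level k m ∧
      (level k n < ⊤ →
        (1 < m →
          waring (FractionRing (MvPowerSeries (Fin s) k)) n = level k m + 1 ∧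
          waring (IterLaurent k s) n = level k m + 1) ∧
        (m = 1 →
          waring (FractionRing (MvPowerSeries (Fin s) k)) n = 1 ∧
          waring (IterLaurent k s) n = 1)) := by
  obtain ⟨hmk, q, j, hq, rfl⟩ := hm.exists_expChar hn
  have hm0 : 0 < m := Nat.pos_of_ne_zero fun h => hmk (by simp [h])
  have hqF : ExpChar (FractionRing (MvPowerSeries (Fin s) k)) q :=
    expChar_of_injective_ringHom (f := (algebraMap (MvPowerSeries (Fin s) k)
      (FractionRing (MvPowerSeries (Fin s) k))).comp MvPowerSeries.C) (RingHom.injective _) q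
  have hqL : ExpChar (IterLaurent k s) q :=
    expChar_of_injective_ringHom (nonempty_ringHom_iterLaurent k s).some.injective q
  have : Nonempty (Fin s) := ⟨⟨0, hs⟩⟩
  simp only [level_expChar_pow_mul q j, waring_expChar_pow_mul q j]
  refine ⟨MvPowerSeries.level_fractionField (Fin s) hm0, level_iterLaurent k hm0 s,
    fun h => ⟨fun hm1 => ⟨MvPowerSeries.waring_fractionField (Fin s) hmk hm1 h, ?_⟩, ?_⟩⟩
  · obtain ⟨r, rfl⟩ := Nat.exists_eq_succ_of_ne_zero hs.ne'
    exact waring_iterLaurent_succ k hmk hm1 h r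
  · rintro rfl
    exact ⟨waring_one _, waring_one _⟩
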